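/- Let p be a prime with p ≡ 3 (mod 4), n an even positive integer, and f : F_{p^n} → F_p a weakly regular bent function with W_f(b) = u (−p)^{n/2} ω_p^{f*(b)} for all b (u ∈ {1,−1}; note p* = −p here), such that f(tx) = t^k f(x) for all t ∈ F_p, x ∈ F_{p^n} with gcd(k−1,p−1) = 1. Then in the complex group algebra ℂ[(F_{p^n},+)]: (p·D_R − ((p−1)/2)·[F_{p^n}])² = ((p²−1)/4)·p^n·[0] + u·(−p)^{n/2}·(p·D_R − ((p−1)/2)·[F_{p^n}]); the same identity holds with D_R replaced by D_N; and p²·D_0² = (−p^n + 2p|D_0| − u·(−p)^{n/2}·(p−2))·[F_{p^n}] + u·p·(p−2)·(−p)^{n/2}·D_0 + (p−1)·p^n·[0]. -/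

import Mathlib

open Finset

noncomputable section
open scoped Classical

noncomputable instance (p n : ℕ) [Fact p.Prime] : Fintype (GaloisField p n) :=
  Fintype.ofFinite _

/-- `ω_p^a` for `a ∈ F_p`, where `ω_p = exp(2πi/p)`. -/
def ez (p : ℕ) (a : ZMod p) : ℂ :=
  Complex.exp (2 * Real.pi * Complex.I * (a.val : ℂ) / p)

/-- The Walsh coefficient `W_f(b) = ∑_{x∈F_{p^n}} ω_p^{f(x)+Tr(bx)}`. -/
def walsh (p n : ℕ) [Fact p.Prime] (f : GaloisField p n → ZMod p) (b : GaloisField p n) : ℂ :=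
  ∑ x : GaloisField p n,
    ez p (f x + Algebra.trace (ZMod p) (GaloisField p n) (b * x))

/-- The quadratic Gauss sum `G = ∑_{t∈F_p} ω_p^{t²}`. -/
def gaussSum' (p : ℕ) [NeZero p] : ℂ := ∑ t : ZMod p, ez p (t ^ 2)

/-- The element `∑_{x∈S} x` of the group algebra `ℂ[(F_{p^n},+)]` attached to a subset `S`. -/
def elt (p n : ℕ) [Fact p.Prime] (S : Finset (GaloisField p n)) :
    AddMonoidAlgebra ℂ (GaloisField p n) :=
  ∑ x ∈ S, AddMonoidAlgebra.single x (1 : ℂ)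

lemma ez_eq_stdAddChar (p : ℕ) [Fact p.Prime] (a : ZMod p) : ez p a = ZMod.stdAddChar a := by
  rw [ZMod.stdAddChar_apply, ZMod.toCircle_apply, ez]

/-- The canonical additive character `x ↦ ω_p^{Tr x}` of `F_{p^n}`. -/
def traceChar (p n : ℕ) [Fact p.Prime] : AddChar (GaloisField p n) ℂ :=
  (ZMod.stdAddChar (N := p)).compAddMonoidHom
    (Algebra.trace (ZMod p) (GaloisField p n)).toAddMonoidHom

lemma traceChar_apply (p n : ℕ) [Fact p.Prime] (x : GaloisField p n) :
    traceChar p n x = ZMod.stdAddChar (Algebra.trace (ZMod p) (GaloisField p n) x) := rfl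

lemma isPrimitive_traceChar (p n : ℕ) [Fact p.Prime] : (traceChar p n).IsPrimitive := by
  apply AddChar.IsPrimitive.of_ne_one
  intro h
  obtain ⟨x, hx⟩ := Algebra.trace_surjective (ZMod p) (GaloisField p n) 1
  have h1 : traceChar p n x = 1 := by rw [h]; rfl
  rw [traceChar_apply, hx, ← AddChar.map_zero_eq_one (ZMod.stdAddChar (N := p))] at h1
  exact one_ne_zero (ZMod.injective_stdAddChar h1)

/-- The Fourier transform at `b` on the group algebra, as an algebra homomorphism. -/
def fourierHom (p n : ℕ) [Fact p.Prime] (b : GaloisField p n) :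
    AddMonoidAlgebra ℂ (GaloisField p n) →ₐ[ℂ] ℂ :=
  AddMonoidAlgebra.lift ℂ ℂ (GaloisField p n) ((traceChar p n).mulShift b).toMonoidHom

lemma fourierHom_single (p n : ℕ) [Fact p.Prime] (b x : GaloisField p n) (r : ℂ) :
    fourierHom p n b (AddMonoidAlgebra.single x r) = r * traceChar p n (b * x) := by
  rw [fourierHom, AddMonoidAlgebra.lift_single]
  rfl

lemma fourierHom_inversion (p n : ℕ) [Fact p.Prime] (A : AddMonoidAlgebra ℂ (GaloisField p n))
    (y : GaloisField p n) :
    ∑ b, traceChar p n (-(b * y)) * fourierHom p n b A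
      = (Fintype.card (GaloisField p n) : ℂ) * A.coeff y := by
  induction A using AddMonoidAlgebra.induction_linear with
  | zero => simp
  | add A B hA hB => simp [mul_add, Finset.sum_add_distrib, hA, hB]
  | single x r =>
    have h : ∀ b, traceChar p n (-(b * y)) * fourierHom p n b (AddMonoidAlgebra.single x r)
        = r * traceChar p n (b * (x - y)) := by
      intro b
      rw [fourierHom_single, mul_left_comm, ← AddChar.map_add_eq_mul]
      congr 2
      ring
    rw [Finset.sum_congr rfl fun b _ => h b, ← Finset.mul_sum,
      AddChar.sum_mulShift _ (isPrimitive_traceChar p n), AddMonoidAlgebra.coeff_single, Finsupp.single_apply]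
    by_cases hxy : x = y
    · simp [hxy, mul_comm]
    · simp [hxy, sub_eq_zero]

lemma fourierHom_ext (p n : ℕ) [Fact p.Prime] {A B : AddMonoidAlgebra ℂ (GaloisField p n)}
    (h : ∀ b, fourierHom p n b A = fourierHom p n b B) : A = B := by
  ext y
  have hA := fourierHom_inversion p n A y
  simp only [h, fourierHom_inversion p n B y] at hA
  exact (mul_left_cancel₀ (Nat.cast_ne_zero.mpr Fintype.card_ne_zero) hA).symm

lemma fourierHom_elt (p n : ℕ) [Fact p.Prime] (b : GaloisField p n)
    (S : Finset (GaloisField p n)) :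
    fourierHom p n b (elt p n S) = ∑ x ∈ S, traceChar p n (b * x) := by
  simp [elt, map_sum, fourierHom_single]

lemma fourierHom_elt_univ (p n : ℕ) [Fact p.Prime] (b : GaloisField p n) :
    fourierHom p n b (elt p n univ)
      = if b = 0 then (Fintype.card (GaloisField p n) : ℂ) else 0 := by
  rw [fourierHom_elt]
  simp only [mul_comm b]
  rw [AddChar.sum_mulShift _ (isPrimitive_traceChar p n)]
  split_ifs <;> simp

/-- Galois conjugation: an identity between an integer multiple of a `p`-th root of unity and
a sum of `p`-th roots of unity survives raising every root of unity to the `s`-th power. -/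
lemma sum_stdAddChar_conj (p : ℕ) [Fact p.Prime] {ι : Type*} [Fintype ι] (a : ι → ZMod p)
    (v : ZMod p) (c : ℤ) (h : ∑ i, ZMod.stdAddChar (a i) = (c : ℂ) * ZMod.stdAddChar v)
    (s : (ZMod p)ˣ) :
    ∑ i, ZMod.stdAddChar ((s : ZMod p) * a i) = (c : ℂ) * ZMod.stdAddChar ((s : ZMod p) * v) := by
  have hp : p ≠ 0 := (Fact.out : p.Prime).ne_zero
  set ζ : ℂ := ZMod.stdAddChar (1 : ZMod p)
  have hζ : IsPrimitiveRoot ζ p := by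
    have h1 := Complex.isPrimitiveRoot_exp p hp
    convert h1 using 1
    have := ZMod.stdAddChar_coe (N := p) 1
    simpa using this
  have hpow : ∀ x : ZMod p, ZMod.stdAddChar x = ζ ^ x.val := by
    intro x
    rw [← AddChar.map_nsmul_eq_pow]
    simp
  have hspow : ∀ x : ZMod p, ZMod.stdAddChar ((s : ZMod p) * x)
      = (ζ ^ (s : ZMod p).val) ^ x.val := by
    intro x
    rw [← pow_mul, ← AddChar.map_nsmul_eq_pow]
    simp
  let P : Polynomial ℤ :=
    ∑ i, Polynomial.X ^ (a i).val - Polynomial.C c * Polynomial.X ^ v.val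
  have hP : Polynomial.aeval ζ P = 0 := by
    simp only [P, map_sub, map_sum, map_mul, map_pow, Polynomial.aeval_X, Polynomial.aeval_C,
      ← hpow, h]
    simp
  have hdvd : minpoly ℤ (ζ ^ (s : ZMod p).val) ∣ P := by
    rw [← hζ.minpoly_eq_pow_coprime (ZMod.val_coe_unit_coprime s)]
    exact minpoly.isIntegrallyClosed_dvd (hζ.isIntegral (Nat.pos_of_ne_zero hp)) hP
  have hPs : Polynomial.aeval (ζ ^ (s : ZMod p).val) P = 0 := by
    obtain ⟨Q, hQ⟩ := hdvd
    rw [hQ, map_mul, minpoly.aeval, zero_mul]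
  simp only [P, map_sub, map_sum, map_mul, map_pow, Polynomial.aeval_X, Polynomial.aeval_C,
    ← hspow] at hPs
  simpa [sub_eq_zero] using hPs

/-- For `f` homogeneous of degree `k` with Walsh coefficients `c * ω_p^{f*(b)}`, the twisted Walsh
coefficient of `t^{k-1} f` at `b` is `c * ω_p^{t⁻¹ f*(b)}`. -/
lemma walsh_pow_smul (p n : ℕ) [Fact p.Prime] (f fstar : GaloisField p n → ZMod p) (c : ℤ)
    (hW : ∀ b, walsh p n f b = (c : ℂ) * ez p (fstar b)) (k : ℕ) (hk : 0 < k)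
    (hhom : ∀ (t : ZMod p) (x : GaloisField p n),
      f (algebraMap (ZMod p) (GaloisField p n) t * x) = t ^ k * f x)
    (b : GaloisField p n) (t : (ZMod p)ˣ) :
    ∑ x, ZMod.stdAddChar (((t ^ (k - 1) : (ZMod p)ˣ) : ZMod p) * f x) * traceChar p n (b * x)
      = (c : ℂ) * ZMod.stdAddChar (((t⁻¹ : (ZMod p)ˣ) : ZMod p) * fstar b) := by
  have hb := hW b
  simp only [walsh, ez_eq_stdAddChar] at hb
  rw [← sum_stdAddChar_conj p _ _ c hb t⁻¹]
  have ht : algebraMap (ZMod p) (GaloisField p n) (t : ZMod p) ≠ 0 := by simp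
  obtain ⟨m, rfl⟩ : ∃ m, k = m + 1 := ⟨k - 1, by omega⟩
  have htr : ∀ x, Algebra.trace (ZMod p) (GaloisField p n)
      (b * (algebraMap (ZMod p) (GaloisField p n) t * x))
        = t * Algebra.trace (ZMod p) (GaloisField p n) (b * x) := by
    intro x
    rw [mul_left_comm, ← Algebra.smul_def, LinearMap.map_smul, smul_eq_mul]
  have hcancel : ∀ y z : ZMod p, ((t⁻¹ : (ZMod p)ˣ) : ZMod p) * ((t : ZMod p) ^ (m + 1) * y + t * z)
      = (t : ZMod p) ^ m * y + z := by
    intro y z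
    rw [pow_succ]
    linear_combination ((t : ZMod p) ^ m * y + z) * t.inv_mul
  rw [← (mulLeft_bijective₀ _ ht).sum_comp fun x => (ZMod.stdAddChar
    (((t⁻¹ : (ZMod p)ˣ) : ZMod p) *
      (f x + Algebra.trace (ZMod p) (GaloisField p n) (b * x))) : ℂ)]
  refine Finset.sum_congr rfl fun x _ => ?_
  rw [hhom, htr, hcancel, traceChar_apply, ← AddChar.map_add_eq_mul, Nat.add_sub_cancel,
    Units.val_pow_eq_pow_val]

/-- Weighted form of `walsh_pow_smul`, for weights `w` on the units with `w (t^{k-1}) = w (t⁻¹)`. -/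
lemma sum_weighted (p n : ℕ) [Fact p.Prime] (f fstar : GaloisField p n → ZMod p) (c : ℤ)
    (hW : ∀ b, walsh p n f b = (c : ℂ) * ez p (fstar b)) (k : ℕ) (hk : 0 < k)
    (hkgcd : Nat.gcd (k - 1) (p - 1) = 1)
    (hhom : ∀ (t : ZMod p) (x : GaloisField p n),
      f (algebraMap (ZMod p) (GaloisField p n) t * x) = t ^ k * f x)
    (w : (ZMod p)ˣ → ℂ) (hw : ∀ t, w (t ^ (k - 1)) = w t⁻¹) (b : GaloisField p n) :
    ∑ x, (∑ j : (ZMod p)ˣ, w j * ZMod.stdAddChar ((j : ZMod p) * f x)) * traceChar p n (b * x)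
      = (c : ℂ) * ∑ j : (ZMod p)ˣ, w j * ZMod.stdAddChar ((j : ZMod p) * fstar b) := by
  have hcop : (Nat.card (ZMod p)ˣ).Coprime (k - 1) := by
    rw [Nat.card_eq_fintype_card, ZMod.card_units]
    exact (Nat.coprime_iff_gcd_eq_one.mpr hkgcd).symm
  simp only [Finset.sum_mul]
  rw [Finset.sum_comm, ← Equiv.sum_comp (powCoprime hcop),
    ← Equiv.sum_comp (Equiv.inv (ZMod p)ˣ) fun j => w j * ZMod.stdAddChar ((j : ZMod p) * fstar b),
    Finset.mul_sum]
  refine Finset.sum_congr rfl fun t _ => ?_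
  simp only [powCoprime_apply, Equiv.inv_apply, hw, mul_assoc]
  rw [← Finset.mul_sum, walsh_pow_smul p n f fstar c hW k hk hhom b t]
  ring

lemma sum_units_eq_sub (p : ℕ) [Fact p.Prime] (g : ZMod p → ℂ) :
    ∑ j : (ZMod p)ˣ, g j = ∑ j, g j - g 0 := by
  rw [← Finset.add_sum_erase univ g (mem_univ 0), add_sub_cancel_left]
  refine Finset.sum_bij (fun j _ => (j : ZMod p)) (by simp) (fun _ _ _ _ h => Units.ext h)
    (fun j hj => ⟨Units.mk0 j (Finset.ne_of_mem_erase hj), mem_univ _, rfl⟩) (fun _ _ => rfl)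

lemma sum_units_stdAddChar (p : ℕ) [Fact p.Prime] (a : ZMod p) :
    ∑ j : (ZMod p)ˣ, ZMod.stdAddChar ((j : ZMod p) * a) = (if a = 0 then (p : ℂ) else 0) - 1 := by
  rw [sum_units_eq_sub p fun j => (ZMod.stdAddChar (j * a) : ℂ),
    AddChar.sum_mulShift _ (ZMod.isPrimitive_stdAddChar p)]
  simp

lemma sum_units_quadraticChar (p : ℕ) [Fact p.Prime] (hp2 : p ≠ 2) :
    ∃ G : ℂ, G ≠ 0 ∧ ∀ a : ZMod p,
      ∑ j : (ZMod p)ˣ, (quadraticChar (ZMod p) j : ℂ) * ZMod.stdAddChar ((j : ZMod p) * a)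
        = G * (quadraticChar (ZMod p) a : ℂ) := by
  let χ : MulChar (ZMod p) ℂ := (quadraticChar (ZMod p)).ringHomComp (Int.castRingHom ℂ)
  have hχ1 : χ ≠ 1 := by
    have := quadraticChar_ne_one (F := ZMod p) (by rwa [ZMod.ringChar_zmod_n])
    exact (MulChar.ringHomComp_ne_one_iff Int.cast_injective).mpr this
  refine ⟨gaussSum χ ZMod.stdAddChar, gaussSum_ne_zero_of_nontrivial ?_ hχ1
    (ZMod.isPrimitive_stdAddChar p), fun a => ?_⟩
  · rw [ZMod.card]
    exact_mod_cast (Fact.out : p.Prime).ne_zero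
  rw [sum_units_eq_sub p fun j => (quadraticChar (ZMod p) j : ℂ) * ZMod.stdAddChar (j * a)]
  by_cases ha : a = 0
  · subst ha
    simpa using congrArg (Int.cast : ℤ → ℂ)
      (quadraticChar_sum_zero (F := ZMod p) (by rwa [ZMod.ringChar_zmod_n]))
  · have h := gaussSum_mulShift χ (ZMod.stdAddChar (N := p)) (Units.mk0 a ha)
    have hsq : χ a * χ a = 1 := by
      have := quadraticChar_sq_one (F := ZMod p) ha
      rw [sq] at this
      change ((quadraticChar (ZMod p) a : ℤ) : ℂ) * ((quadraticChar (ZMod p) a : ℤ) : ℂ) = 1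
      exact_mod_cast this
    have e : gaussSum χ ((ZMod.stdAddChar (N := p)).mulShift a)
        = ∑ j, (quadraticChar (ZMod p) j : ℂ) * ZMod.stdAddChar (j * a) := by
      simp only [gaussSum, AddChar.mulShift_apply, mul_comm a]
      rfl
    have h0 : (quadraticChar (ZMod p) 0 : ℂ) = 0 := by simp
    rw [h0, zero_mul, sub_zero, ← e, ← h]
    change _ = χ a * _ * χ a
    rw [mul_right_comm, hsq, one_mul, Units.val_mk0]

/-- A function `g` in the span of `p δ₀ - 1` and the quadratic character satisfies
`∑ x, g (f x) ω_p^{Tr(bx)} = c * g (f* b)`. -/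
lemma sum_comp_mul_traceChar (p n : ℕ) [Fact p.Prime] (hp2 : p ≠ 2)
    (f fstar : GaloisField p n → ZMod p) (c : ℤ)
    (hW : ∀ b, walsh p n f b = (c : ℂ) * ez p (fstar b)) (k : ℕ) (hk : 0 < k)
    (hkgcd : Nat.gcd (k - 1) (p - 1) = 1)
    (hhom : ∀ (t : ZMod p) (x : GaloisField p n),
      f (algebraMap (ZMod p) (GaloisField p n) t * x) = t ^ k * f x)
    (g : ZMod p → ℂ) (α β : ℂ)
    (hg : ∀ a, g a = α * ((if a = 0 then (p : ℂ) else 0) - 1) + β * (quadraticChar (ZMod p) a : ℂ))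
    (b : GaloisField p n) :
    ∑ x, g (f x) * traceChar p n (b * x) = (c : ℂ) * g (fstar b) := by
  obtain ⟨G, hG, hsum⟩ := sum_units_quadraticChar p hp2
  have hodd : Odd (k - 1) := by
    have hpo := (Fact.out : p.Prime).eq_two_or_odd
    by_contra h
    rw [Nat.not_odd_iff_even] at h
    have h2 : 2 ∣ Nat.gcd (k - 1) (p - 1) := Nat.dvd_gcd h.two_dvd (by omega)
    omega
  have h1 := sum_weighted p n f fstar c hW k hk hkgcd hhom (fun _ => 1) (fun _ => rfl) b
  have h2 := sum_weighted p n f fstar c hW k hk hkgcd hhom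
    (fun t => (quadraticChar (ZMod p) t : ℂ)) (fun t => by
      obtain ⟨m, hm⟩ := hodd
      have ht : (quadraticChar (ZMod p) (t : ZMod p)) ^ 2 = 1 := quadraticChar_sq_one t.ne_zero
      have hinv : quadraticChar (ZMod p) (t : ZMod p) *
          quadraticChar (ZMod p) ((t⁻¹ : (ZMod p)ˣ) : ZMod p) = 1 := by
        rw [← map_mul, Units.mul_inv, map_one]
      have hti : quadraticChar (ZMod p) ((t⁻¹ : (ZMod p)ˣ) : ZMod p)
          = quadraticChar (ZMod p) (t : ZMod p) := by
        linear_combination (quadraticChar (ZMod p) (t : ZMod p)) * hinv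
          - (quadraticChar (ZMod p) ((t⁻¹ : (ZMod p)ˣ) : ZMod p)) * ht
      rw [hti, Units.val_pow_eq_pow_val, map_pow, hm, pow_succ, pow_mul, ht, one_pow, one_mul]) b
  simp only [one_mul, sum_units_stdAddChar] at h1
  simp only [hsum, mul_assoc] at h2
  rw [← Finset.mul_sum, mul_left_comm] at h2
  have h3 := mul_left_cancel₀ hG h2
  simp only [hg, add_mul, Finset.sum_add_distrib, mul_assoc, ← Finset.mul_sum, h1, h3]
  ring

/-- A level-set element whose indicator lies in the span of `p δ₀ - 1` and the quadratic character
satisfies the quadratic equation that its Fourier coefficients satisfy. -/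
lemma elt_filter_quadratic (p n : ℕ) [Fact p.Prime] (hp2 : p ≠ 2)
    (f fstar : GaloisField p n → ZMod p) (c : ℤ) (hc : (c : ℂ) ^ 2 = (p : ℂ) ^ n)
    (hW : ∀ b, walsh p n f b = (c : ℂ) * ez p (fstar b)) (k : ℕ) (hk : 0 < k)
    (hkgcd : Nat.gcd (k - 1) (p - 1) = 1)
    (hhom : ∀ (t : ZMod p) (x : GaloisField p n),
      f (algebraMap (ZMod p) (GaloisField p n) t * x) = t ^ k * f x)
    (P : ZMod p → Prop)
    (S : Finset (GaloisField p n)) (hS : ∀ x, x ∈ S ↔ P (f x)) (q r s α β : ℂ)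
    (hP : ∀ a, (if P a then (p : ℂ) else 0) - q
      = α * ((if a = 0 then (p : ℂ) else 0) - 1) + β * (quadraticChar (ZMod p) a : ℂ))
    (h1 : ((p : ℂ) - q) ^ 2 = r * (p - q) + s) (h0 : q ^ 2 = s - r * q) :
    ((p : ℂ) • elt p n S - q • elt p n univ) ^ 2
      = (s * (p : ℂ) ^ n) • (1 : AddMonoidAlgebra ℂ (GaloisField p n))
        + ((c : ℂ) * r) • ((p : ℂ) • elt p n S - q • elt p n univ) := by
  obtain rfl : S = univ.filter fun x => P (f x) := by ext x; simp [hS]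
  have hX : ∀ b, fourierHom p n b
      ((p : ℂ) • elt p n (univ.filter fun x => P (f x)) - q • elt p n univ)
        = (c : ℂ) * ((if P (fstar b) then (p : ℂ) else 0) - q) := by
    intro b
    rw [← sum_comp_mul_traceChar p n hp2 f fstar c hW k hk hkgcd hhom _ α β hP b]
    simp only [map_sub, map_smul, fourierHom_elt, Finset.sum_filter, smul_eq_mul, sub_mul,
      Finset.sum_sub_distrib, ← Finset.mul_sum, ite_mul, zero_mul]
    rw [Finset.mul_sum]
    simp only [mul_ite, mul_zero]
  refine fourierHom_ext p n fun b => ?_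
  rw [map_pow, map_add, map_smul, map_smul, map_one, hX, ← hc]
  simp only [smul_eq_mul]
  split_ifs
  · linear_combination (c : ℂ) ^ 2 * h1
  · linear_combination (c : ℂ) ^ 2 * h0

lemma elt_mul_elt_univ (p n : ℕ) [Fact p.Prime] (S : Finset (GaloisField p n)) :
    elt p n S * elt p n univ = (S.card : ℂ) • elt p n univ := by
  refine fourierHom_ext p n fun b => ?_
  rw [map_mul, map_smul, fourierHom_elt_univ, fourierHom_elt]
  by_cases hb : b = 0 <;> simp [hb]

/-- **Case 2 of the proof of Theorem 3.5** (`p ≡ 3 (mod 4)`): in `ℂ[(F_{p^n},+)]`,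
`(pD_R − ((p−1)/2)[F_{p^n}])² = ((p²−1)/4)p^n·[0] + u(−p)^{n/2}(pD_R − ((p−1)/2)[F_{p^n}])`,
the same identity with `D_R` replaced by `D_N`, and
`p²D_0² = (−p^n + 2p|D_0| − u(−p)^{n/2}(p−2))[F_{p^n}] + u p(p−2)(−p)^{n/2} D_0 + (p−1)p^n·[0]`. -/
theorem group_ring_identities_three_mod_four
    (p : ℕ) [Fact p.Prime] (hp4 : p % 4 = 3) (n : ℕ) (hn : 0 < n) (hneven : Even n)
    (f fstar : GaloisField p n → ZMod p) (u : ℤ) (hu : u = 1 ∨ u = -1)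
    (hW : ∀ b : GaloisField p n,
      walsh p n f b = (u : ℂ) * (-(p : ℂ)) ^ (n / 2) * ez p (fstar b))
    (k : ℕ) (hk : 0 < k) (hkgcd : Nat.gcd (k - 1) (p - 1) = 1)
    (hhom : ∀ (t : ZMod p) (x : GaloisField p n),
      f (algebraMap (ZMod p) (GaloisField p n) t * x) = t ^ k * f x) :
    (((p : ℂ) • elt p n (Finset.univ.filter fun x => f x ≠ 0 ∧ IsSquare (f x))
        - (((p : ℂ) - 1) / 2) • elt p n Finset.univ) ^ 2
      = (((p : ℂ) ^ 2 - 1) / 4 * (p : ℂ) ^ n) • (1 : AddMonoidAlgebra ℂ (GaloisField p n))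
        + ((u : ℂ) * (-(p : ℂ)) ^ (n / 2)) •
            ((p : ℂ) • elt p n (Finset.univ.filter fun x => f x ≠ 0 ∧ IsSquare (f x))
              - (((p : ℂ) - 1) / 2) • elt p n Finset.univ)) ∧
    (((p : ℂ) • elt p n (Finset.univ.filter fun x => ¬IsSquare (f x))
        - (((p : ℂ) - 1) / 2) • elt p n Finset.univ) ^ 2
      = (((p : ℂ) ^ 2 - 1) / 4 * (p : ℂ) ^ n) • (1 : AddMonoidAlgebra ℂ (GaloisField p n))
        + ((u : ℂ) * (-(p : ℂ)) ^ (n / 2)) •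
            ((p : ℂ) • elt p n (Finset.univ.filter fun x => ¬IsSquare (f x))
              - (((p : ℂ) - 1) / 2) • elt p n Finset.univ)) ∧
    (((p : ℂ) ^ 2) • elt p n (Finset.univ.filter fun x => f x = 0) ^ 2
      = (-(p : ℂ) ^ n + 2 * (p : ℂ) * ((Finset.univ.filter fun x => f x = 0).card : ℂ)
            - (u : ℂ) * (-(p : ℂ)) ^ (n / 2) * ((p : ℂ) - 2)) • elt p n Finset.univ
        + ((u : ℂ) * (p : ℂ) * ((p : ℂ) - 2) * (-(p : ℂ)) ^ (n / 2)) •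
            elt p n (Finset.univ.filter fun x => f x = 0)
        + (((p : ℂ) - 1) * (p : ℂ) ^ n) • (1 : AddMonoidAlgebra ℂ (GaloisField p n))) := by
  have hp2 : p ≠ 2 := by rintro rfl; omega
  obtain ⟨c, hc⟩ : ∃ c : ℤ, (c : ℂ) = (u : ℂ) * (-(p : ℂ)) ^ (n / 2) :=
    ⟨u * (-(p : ℤ)) ^ (n / 2), by push_cast; rfl⟩
  have hc2 : (c : ℂ) ^ 2 = (p : ℂ) ^ n := by
    have hu2 : (u : ℂ) ^ 2 = 1 := by rcases hu with rfl | rfl <;> norm_num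
    rw [hc, mul_pow, hu2, one_mul, pow_right_comm, neg_sq, ← pow_mul,
      Nat.mul_div_cancel' hneven.two_dvd]
  simp only [← hc] at hW
  have key := elt_filter_quadratic p n hp2 f fstar c hc2 hW k hk hkgcd hhom
  have hη : ∀ a : ZMod p, a ≠ 0 → IsSquare a → quadraticChar (ZMod p) a = 1 :=
    fun a ha h => (quadraticChar_one_iff_isSquare ha).mpr h
  have hη' : ∀ a : ZMod p, ¬IsSquare a → quadraticChar (ZMod p) a = -1 :=
    fun a h => quadraticChar_neg_one_iff_not_isSquare.mpr h
  refine ⟨?_, ?_, ?_⟩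
  · have h := key (fun a => a ≠ 0 ∧ IsSquare a) (univ.filter fun x => f x ≠ 0 ∧ IsSquare (f x)) (by simp)
      (((p : ℂ) - 1) / 2) 1 (((p : ℂ) ^ 2 - 1) / 4)
      (-1 / 2) (p / 2) (fun a => ?_) (by ring) (by ring)
    · rw [mul_one, hc] at h
      exact h
    · by_cases ha : a = 0
      · simp [ha]; ring
      by_cases hs : IsSquare a
      · simp [ha, hs, hη a ha hs]; ring
      · simp [ha, hs, hη' a hs]; ring
  · have h := key (fun a => ¬IsSquare a) (univ.filter fun x => ¬IsSquare (f x)) (by simp)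
      (((p : ℂ) - 1) / 2) 1 (((p : ℂ) ^ 2 - 1) / 4)
      (-1 / 2) (-p / 2) (fun a => ?_) (by ring) (by ring)
    · rw [mul_one, hc] at h
      exact h
    · by_cases ha : a = 0
      · simp [ha]; ring
      by_cases hs : IsSquare a
      · simp [ha, hs, hη a ha hs]; ring
      · simp [ha, hs, hη' a hs]; ring
  · have h := key (fun a => a = 0) (univ.filter fun x => f x = 0) (by simp)
      1 (p - 2) (p - 1) 1 0 (fun a => by simp) (by ring) (by ring)
    have hcard : ((univ : Finset (GaloisField p n)).card : ℂ) = (p : ℂ) ^ n := by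
      rw [card_univ, ← Nat.card_eq_fintype_card, GaloisField.card p n hn.ne', Nat.cast_pow]
    have hF := elt_mul_elt_univ p n univ
    rw [hcard] at hF
    rw [sub_sq, one_smul, smul_pow, sq (elt p n univ), hF, mul_assoc, smul_mul_assoc,
      elt_mul_elt_univ, two_mul] at h
    rw [show (u : ℂ) * p * (p - 2) * (-(p : ℂ)) ^ (n / 2) = c * (p * (p - 2)) by rw [hc]; ring, ← hc]
    linear_combination (norm := module) h
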